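/- Assume (f_n) is a sequence of monotone non-expansive functions f_n : X → X converging pointwise to a function f : X → X, where f is a power contraction, i.e. there exist m ∈ ℕ, m ≥ 1, and q < 1 such that the m-fold iterate f^m is q-Lipschitz for the supremum norm. Let (α_n), (β_n) be sequences in [0,1) with lim α_n = 0 and lim β_n = 0, let x_0 ∈ X, and let (x_n) be the dampened Mann iteration with function sequence (f_n). If (x_n) is bounded, then (x_n) converges to the unique fixpoint of f. -/

import Mathlib

open Filter Set Topology

/-- The dampened Mann iteration:
`x₀ = x0`, `x_{n+1} = (1 - β n) • (α n • x n + (1 - α n) • f n (x n))`. -/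
noncomputable def mannSeq {E : Type*} [AddCommGroup E] [Module ℝ E]
    (α β : ℕ → ℝ) (f : ℕ → E → E) (x0 : E) : ℕ → E
  | 0 => x0
  | n + 1 => (1 - β n) • (α n • mannSeq α β f x0 n + (1 - α n) • f n (mannSeq α β f x0 n))

/-- A bounded nonnegative sequence with `a (n + m) ≤ q * a n + e n`, `q < 1` and `e → 0`
tends to zero. -/
theorem tendsto_zero_of_le_mul_add {a e : ℕ → ℝ} {m : ℕ} {q C : ℝ} (hq0 : 0 ≤ q) (hq : q < 1)
    (ha0 : ∀ n, 0 ≤ a n) (haC : ∀ n, a n ≤ C) (hrec : ∀ n, a (n + m) ≤ q * a n + e n)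
    (he : Tendsto e atTop (𝓝 0)) : Tendsto a atTop (𝓝 0) := by
  have hq1 : 0 < 1 - q := by linarith
  have key : ∀ ε > 0, ∀ k : ℕ, ∀ᶠ n in atTop, a n ≤ q ^ k * C + ε / (1 - q) := by
    intro ε hε k
    induction k with
    | zero =>
      refine Eventually.of_forall fun n => ?_
      have : 0 ≤ ε / (1 - q) := by positivity
      linarith [haC n]
    | succ k ih =>
      obtain ⟨N, hN⟩ := eventually_atTop.1 (ih.and (he.eventually_lt_const hε))
      refine eventually_atTop.2 ⟨N + m, fun n hn => ?_⟩
      obtain ⟨j, rfl⟩ : ∃ j, n = j + m := ⟨n - m, by omega⟩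
      obtain ⟨h1, h2⟩ := hN j (by omega)
      calc a (j + m) ≤ q * a j + e j := hrec j
        _ ≤ q * (q ^ k * C + ε / (1 - q)) + ε := by gcongr
        _ = q ^ (k + 1) * C + ε / (1 - q) := by field_simp; ring
  have hpow : Tendsto (fun k : ℕ => q ^ k * C) atTop (𝓝 0) := by
    simpa using (tendsto_pow_atTop_nhds_zero_of_lt_one hq0 hq).mul_const C
  refine tendsto_order.2 ⟨fun b hb => Eventually.of_forall fun n => hb.trans_le (ha0 n),
    fun δ hδ => ?_⟩
  obtain ⟨k, hk⟩ := (hpow.eventually_lt_const (half_pos hδ)).exists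
  filter_upwards [key (δ / 2 * (1 - q)) (by positivity) k] with n hn
  rw [mul_div_cancel_right₀ _ hq1.ne'] at hn
  linarith

/-- A pointwise limit of non-expansive maps is non-expansive. -/
theorem LipschitzOnWith.of_tendsto_pointwise {E F : Type*} [PseudoMetricSpace E]
    [PseudoMetricSpace F] {K : NNReal} {s : Set E} {fn : ℕ → E → F} {f : E → F}
    (hfn : ∀ n, LipschitzOnWith K (fn n) s)
    (hconv : ∀ x ∈ s, Tendsto (fun n => fn n x) atTop (𝓝 (f x))) : LipschitzOnWith K f s :=
  LipschitzOnWith.of_dist_le_mul fun x hx y hy =>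
    le_of_tendsto ((hconv x hx).dist (hconv y hy))
      (Eventually.of_forall fun n => (hfn n).dist_le_mul x hx y hy)

/-- Non-expansive maps converging pointwise on a closed set converge along every bounded sequence
of that set. -/
theorem tendsto_dist_of_nonexpansive {E F : Type*} [PseudoMetricSpace E] [ProperSpace E]
    [PseudoMetricSpace F] {s : Set E} (hs : IsClosed s) {fn : ℕ → E → F} {f : E → F}
    (hfn : ∀ n, LipschitzOnWith 1 (fn n) s)
    (hconv : ∀ x ∈ s, Tendsto (fun n => fn n x) atTop (𝓝 (f x)))
    {u : ℕ → E} (hu : ∀ n, u n ∈ s) (hb : Bornology.IsBounded (range u)) :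
    Tendsto (fun n => dist (fn n (u n)) (f (u n))) atTop (𝓝 0) := by
  have hf := LipschitzOnWith.of_tendsto_pointwise hfn hconv
  refine tendsto_of_subseq_tendsto fun ns hns => ?_
  obtain ⟨y, -, φ, hφ, hy⟩ := tendsto_subseq_of_bounded hb (x := u ∘ ns) fun n => mem_range_self _
  have hys : y ∈ s := hs.mem_of_tendsto hy (Eventually.of_forall fun n => hu _)
  refine ⟨φ, ?_⟩
  have hN : Tendsto (fun n => ns (φ n)) atTop atTop := hns.comp hφ.tendsto_atTop
  have h1 := hy.dist (tendsto_const_nhds (x := y))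
  have h2 := ((hconv y hys).comp hN).dist (tendsto_const_nhds (x := f y))
  have h3 := (h1.add h2).add h1
  simp only [dist_self, add_zero] at h3
  refine squeeze_zero (fun n => dist_nonneg) (fun n => ?_) h3
  have e1 := (hfn (ns (φ n))).dist_le_mul _ (hu (ns (φ n))) y hys
  have e2 := hf.dist_le_mul y hys _ (hu (ns (φ n)))
  rw [dist_comm y] at e2
  simp only [NNReal.coe_one, one_mul] at e1 e2
  simp only [Function.comp_apply]
  linarith [dist_triangle4 (fn (ns (φ n)) (u (ns (φ n)))) (fn (ns (φ n)) y) (f y)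
    (f (u (ns (φ n))))]

/-- If `u (n + 1)` is asymptotically `f (u n)` for a non-expansive `f`, then `u (n + k)` is
asymptotically `f^[k] (u n)`. -/
theorem tendsto_dist_iterate {E : Type*} [PseudoMetricSpace E] {s : Set E} {f : E → E}
    (hmap : MapsTo f s s) (hf : LipschitzOnWith 1 f s) {u : ℕ → E} (hu : ∀ n, u n ∈ s)
    (h : Tendsto (fun n => dist (u (n + 1)) (f (u n))) atTop (𝓝 0)) (k : ℕ) :
    Tendsto (fun n => dist (u (n + k)) (f^[k] (u n))) atTop (𝓝 0) := by
  induction k with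
  | zero => simp
  | succ k ih =>
    have h3 := (h.comp (tendsto_add_atTop_nat k)).add ih
    rw [add_zero] at h3
    refine squeeze_zero (fun n => dist_nonneg) (fun n => ?_) h3
    have e := hf.dist_le_mul _ (hu (n + k)) _ (hmap.iterate k (hu n))
    simp only [NNReal.coe_one, one_mul] at e
    rw [Function.iterate_succ_apply', ← add_assoc]
    simp only [Function.comp_apply]
    linarith [dist_triangle (u (n + k + 1)) (f (u (n + k))) (f (f^[k] (u n)))]

/-- A map of a nonempty complete set into itself with a contracting iterate has a unique
fixpoint, which is also fixed by that iterate. -/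
theorem exists_unique_fixedPoint_of_iterate {E : Type*} [MetricSpace E] {s : Set E}
    (hs : IsComplete s) (hne : s.Nonempty) {f : E → E} (hmap : MapsTo f s s) {m : ℕ} {q : NNReal}
    (hq : q < 1) (hf : LipschitzOnWith q f^[m] s) :
    ∃ x ∈ s, f x = x ∧ f^[m] x = x ∧ ∀ y ∈ s, f y = y → y = x := by
  obtain ⟨z, hz⟩ := hne
  have huniq : ∀ x ∈ s, ∀ y ∈ s, f^[m] x = x → f^[m] y = y → x = y := by
    intro x hx y hy hfx hfy
    have h := hf.dist_le_mul x hx y hy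
    rw [hfx, hfy] at h
    have hq' : (q : ℝ) < 1 := by exact_mod_cast hq
    exact dist_le_zero.1 (by nlinarith [dist_nonneg (x := x) (y := y)])
  have hc : ContractingWith q ((hmap.iterate m).restrict f^[m] s s) :=
    ⟨hq, fun x y => hf x.2 y.2⟩
  obtain ⟨x, hx, hfix, -⟩ := hc.exists_fixedPoint' hs (hmap.iterate m) hz (edist_ne_top _ _)
  refine ⟨x, hx, ?_, hfix, fun y hy hfy => huniq y hy x hx (Function.iterate_fixed hfy m) hfix⟩
  refine huniq _ (hmap hx) x hx ?_ hfix
  rw [← Function.iterate_succ_apply, Function.iterate_succ_apply', hfix.eq]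

/-- The dampened Mann iteration stays in a convex set containing `0`. -/
theorem mannSeq_mem {E : Type*} [AddCommGroup E] [Module ℝ E] {α β : ℕ → ℝ}
    (hα : ∀ n, α n ∈ Ico (0 : ℝ) 1) (hβ : ∀ n, β n ∈ Ico (0 : ℝ) 1) {X : Set E}
    (hX : Convex ℝ X) (h0 : (0 : E) ∈ X) {f : ℕ → E → E} (hf : ∀ n, MapsTo (f n) X X)
    {x0 : E} (hx0 : x0 ∈ X) (n : ℕ) : mannSeq α β f x0 n ∈ X := by
  induction n with
  | zero => exact hx0
  | succ n ih =>
    have hα' := hα n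
    have hβ' := hβ n
    exact hX.smul_mem_of_zero_mem h0
      (hX ih (hf n ih) hα'.1 (by linarith [hα'.2]) (by ring))
      ⟨by linarith [hβ'.2], by linarith [hβ'.1]⟩

/-- With vanishing parameters, a dampened Mann step along a bounded sequence is asymptotically an
application of the map. -/
theorem tendsto_dist_mannSeq_succ {E : Type*} [NormedAddCommGroup E] [NormedSpace ℝ E]
    {α β : ℕ → ℝ} (hα0 : Tendsto α atTop (𝓝 0)) (hβ0 : Tendsto β atTop (𝓝 0))
    {f : ℕ → E → E} {x0 : E} {C D : ℝ} (hC : ∀ n, ‖mannSeq α β f x0 n‖ ≤ C)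
    (hD : ∀ n, ‖f n (mannSeq α β f x0 n)‖ ≤ D) :
    Tendsto (fun n => dist (mannSeq α β f x0 (n + 1)) (f n (mannSeq α β f x0 n)))
      atTop (𝓝 0) := by
  have hlim : Tendsto (fun n => |1 - β n| * (|α n| * (C + D)) + |β n| * D) atTop (𝓝 0) := by
    have h := (((hβ0.const_sub 1).abs.mul (hα0.abs.mul_const (C + D))).add
      (hβ0.abs.mul_const D))
    simpa using h
  refine squeeze_zero (fun n => dist_nonneg) (fun n => ?_) hlim
  set x := mannSeq α β f x0 n with hx
  have e : mannSeq α β f x0 (n + 1) - f n x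
      = (1 - β n) • α n • (x - f n x) - β n • f n x := by
    simp only [mannSeq, ← hx]
    module
  rw [dist_eq_norm, e]
  refine (norm_sub_le _ _).trans ?_
  simp only [norm_smul, Real.norm_eq_abs]
  gcongr
  · exact (norm_sub_le _ _).trans (add_le_add (hC n) (hD n))
  · exact hD n

/-- if `f` is a power contraction and `αₙ → 0`, `βₙ → 0`, then any
bounded dampened Mann iteration with monotone non-expansive approximations
`fn → f` (pointwise) converges to the unique fixpoint of `f`. -/
theorem mannKleene_convergence_power_contraction
    (α β : ℕ → ℝ) (hα : ∀ n, α n ∈ Set.Ico (0 : ℝ) 1) (hβ : ∀ n, β n ∈ Set.Ico (0 : ℝ) 1)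
    (hα0 : Tendsto α atTop (nhds 0)) (hβ0 : Tendsto β atTop (nhds 0))
    (d : ℕ) (X : Set (Fin d → ℝ)) (hX : IsClosed X) (hXc : Convex ℝ X)
    (hpos : ∀ x ∈ X, ∀ i, 0 ≤ x i) (h0 : (0 : Fin d → ℝ) ∈ X)
    (f : (Fin d → ℝ) → (Fin d → ℝ)) (hmap : Set.MapsTo f X X)
    (m : ℕ) (hm : 1 ≤ m) (q : NNReal) (hq : q < 1)
    (hpc : LipschitzOnWith q (f^[m]) X)
    (fn : ℕ → (Fin d → ℝ) → (Fin d → ℝ))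
    (hfnmap : ∀ n, Set.MapsTo (fn n) X X)
    (hfnmono : ∀ n, ∀ x ∈ X, ∀ y ∈ X, x ≤ y → fn n x ≤ fn n y)
    (hfnne : ∀ n, LipschitzOnWith 1 (fn n) X)
    (hconv : ∀ x ∈ X, Tendsto (fun n => fn n x) atTop (nhds (f x)))
    (x0 : Fin d → ℝ) (hx0 : x0 ∈ X)
    (hbdd : ∃ C, ∀ n, ‖mannSeq α β fn x0 n‖ ≤ C) :
    ∃ xstar, xstar ∈ X ∧ f xstar = xstar ∧ (∀ y ∈ X, f y = y → y = xstar) ∧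
      Tendsto (mannSeq α β fn x0) atTop (nhds xstar) := by
  obtain ⟨C, hC⟩ := hbdd
  set u := mannSeq α β fn x0 with hu
  have huX : ∀ n, u n ∈ X := mannSeq_mem hα hβ hXc h0 hfnmap hx0
  have hf : LipschitzOnWith 1 f X := LipschitzOnWith.of_tendsto_pointwise hfnne hconv
  obtain ⟨x, hx, hfx, hfmx, huniq⟩ :=
    exists_unique_fixedPoint_of_iterate hX.isComplete ⟨0, h0⟩ hmap hq hpc
  refine ⟨x, hx, hfx, huniq, ?_⟩
  obtain ⟨B, hB⟩ : ∃ B, ∀ n, ‖fn n 0‖ ≤ B := by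
    obtain ⟨B, hB⟩ := (hconv 0 h0).norm.bddAbove_range
    exact ⟨B, fun n => hB (mem_range_self n)⟩
  have hD : ∀ n, ‖fn n (u n)‖ ≤ B + C := fun n => by
    have e := (hfnne n).dist_le_mul _ (huX n) 0 h0
    rw [NNReal.coe_one, one_mul, dist_zero_right, dist_eq_norm] at e
    linarith [hB n, hC n, norm_le_norm_add_norm_sub' (fn n (u n)) (fn n 0)]
  have hbd : Bornology.IsBounded (range u) :=
    isBounded_iff_forall_norm_le.2 ⟨C, forall_mem_range.2 hC⟩
  have hstep : Tendsto (fun n => dist (u (n + 1)) (f (u n))) atTop (𝓝 0) := by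
    have h := (tendsto_dist_mannSeq_succ hα0 hβ0 hC hD).add
      (tendsto_dist_of_nonexpansive hX hfnne hconv huX hbd)
    rw [add_zero] at h
    exact squeeze_zero (fun n => dist_nonneg) (fun n => dist_triangle _ _ _) h
  refine tendsto_iff_dist_tendsto_zero.2 (tendsto_zero_of_le_mul_add (m := m) (C := C + ‖x‖)
    q.coe_nonneg (by exact_mod_cast hq) (fun n => dist_nonneg) (fun n => ?_) (fun n => ?_)
    (tendsto_dist_iterate hmap hf huX hstep m))
  · rw [dist_eq_norm]
    exact (norm_sub_le _ _).trans (by gcongr; exact hC n)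
  · have e := hpc.dist_le_mul _ (huX n) x hx
    rw [hfmx] at e
    linarith [dist_triangle (u (n + m)) (f^[m] (u n)) x]
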